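/- arXiv:0906.0918 — 6 statements merged into one kernel-verified Lean document; each statement's English description precedes it below -/
import Mathlib

section
/- There are no free positions under a cap: let f be a weight diagram and (s,t) a cap of f. Then no position u with s < u < t is free for f; that is, for every such u, either f(u) = 1 or u is the end of a cap of f. -/
/-- A weight diagram: a finitely supported function `f : ℕ → ℕ` with `f t ≤ 1` for `t > 0`.
`f t` is the number of crosses at position `t`; position `0` is the tail position. -/
def IsWeightDiagram (f : ℕ → ℕ) : Prop :=
  (Function.support f).Finite ∧ ∀ t : ℕ, 0 < t → f t ≤ 1

/-- `|f| = 2·f(0) + c`, where `c ∈ {0,1}` is the number of core symbols at the tail. -/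
def wsize (c : ℕ) (f : ℕ → ℕ) : ℤ := 2 * (f 0 : ℤ) + (c : ℤ)

/-- `l_f(s,u)`: the number of positions `r` with `s < r < u` and `f r = 1` minus the
number of positions `r` with `s < r < u` and `f r = 0`. -/
def lval (f : ℕ → ℕ) (s u : ℕ) : ℤ :=
  (((Finset.Ioo s u).filter fun r => f r = 1).card : ℤ) -
    (((Finset.Ioo s u).filter fun r => f r = 0).card : ℤ)

/-- `f_s^t`: the diagram obtained from `f` by decreasing its value at `s` by 1 and
increasing its value at `t` by 1. -/
def moveX (f : ℕ → ℕ) (s t : ℕ) : ℕ → ℕ :=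
  fun r => if r = s then f s - 1 else if r = t then f t + 1 else f r

/-- An ordinary legal move on `f` with start `s`, end `t` and degree `w`. -/
structure OrdinaryMove (c : ℕ) (f : ℕ → ℕ) (s t : ℕ) (w : ℕ) : Prop where
  lt : s < t
  startCross : 1 ≤ f s
  endZero : f t = 0
  tailC : s = 0 → c = 0
  nonneg : ∀ u : ℕ, s < u → u ≤ t → 0 ≤ lval f s u
  degEq : (w : ℤ) = lval f s t

/-- A tail legal move on `f` with end `t` and degree `w`; it produces `g = f_0^t`. -/
structure TailMove (c : ℕ) (f : ℕ → ℕ) (t : ℕ) (w : ℕ) : Prop where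
  pos : 0 < t
  startCross : 1 ≤ f 0
  endZero : f t = 0
  mid : ∀ u : ℕ, 0 < u → u < t → 0 < wsize c (moveX f 0 t) + lval f 0 u
  nonneg : 0 ≤ wsize c (moveX f 0 t) + lval f 0 t
  degEq : (w : ℤ) = wsize c (moveX f 0 t) + lval f 0 t

/-- An exceptional move on `f` with intermediate position `s`, end `t` and degree `w`;
it produces `g = (f_0^s)_0^t`. -/
structure ExceptionalMove (c : ℕ) (f : ℕ → ℕ) (s t : ℕ) (w : ℕ) : Prop where
  sPos : 0 < s
  lt : s < t
  sZero : f s = 0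
  endZero : f t = 0
  twoCrosses : 2 ≤ f 0
  left : ∀ a : ℕ, a < s → lval f a s ≤ 0
  oddPos : 0 < wsize c (moveX (moveX f 0 s) 0 t) + lval f 0 s
  odd : Odd (wsize c (moveX (moveX f 0 s) 0 t) + lval f 0 s)
  mid : ∀ u : ℕ, s < u → u ≤ t → 0 ≤ lval f s u
  degEq : (w : ℤ) = lval f s t

/-- The edges of the graph `D` with source `f`: one edge for each ordinary legal move,
tail legal move or exceptional move on `f`. -/
inductive Move (c : ℕ) (f : ℕ → ℕ) : Type
  | ordinary (s t w : ℕ) (h : OrdinaryMove c f s t w) : Move c f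
  | tail (t w : ℕ) (h : TailMove c f t w) : Move c f
  | exceptional (s t w : ℕ) (h : ExceptionalMove c f s t w) : Move c f

namespace Move

/-- The diagram produced by a move. -/
def target {c : ℕ} {f : ℕ → ℕ} : Move c f → (ℕ → ℕ)
  | ordinary s t _ _ => moveX f s t
  | tail t _ _ => moveX f 0 t
  | exceptional s t _ _ => moveX (moveX f 0 s) 0 t

/-- The end position of a move. -/
def endPos {c : ℕ} {f : ℕ → ℕ} : Move c f → ℕ
  | ordinary _ t _ _ => t
  | tail t _ _ => t
  | exceptional _ t _ _ => t

/-- The degree of a move. -/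
def deg {c : ℕ} {f : ℕ → ℕ} : Move c f → ℕ
  | ordinary _ _ w _ => w
  | tail _ w _ => w
  | exceptional _ _ w _ => w

end Move

/-- Paths in the graph `D`: finite sequences of composable edges. -/
inductive DPath (c : ℕ) : (ℕ → ℕ) → (ℕ → ℕ) → Type
  | nil (f : ℕ → ℕ) : DPath c f f
  | cons {f g : ℕ → ℕ} (m : Move c f) (p : DPath c m.target g) : DPath c f g

namespace DPath

/-- The degree `l(R)` of a path: the sum of the degrees of its edges. -/
def deg {c : ℕ} : {f g : ℕ → ℕ} → DPath c f g → ℕ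
  | _, _, nil _ => 0
  | _, _, cons m p => m.deg + p.deg

/-- The number `|R|` of edges of a path. -/
def length {c : ℕ} : {f g : ℕ → ℕ} → DPath c f g → ℕ
  | _, _, nil _ => 0
  | _, _, cons _ p => p.length + 1

/-- The list of ends of the successive edges of a path. -/
def ends {c : ℕ} : {f g : ℕ → ℕ} → DPath c f g → List ℕ
  | _, _, nil _ => []
  | _, _, cons m p => m.endPos :: p.ends

/-- A path is decreasing if the ends of its successive edges strictly decrease. -/
def Decreasing {c : ℕ} {f g : ℕ → ℕ} (p : DPath c f g) : Prop :=
  p.ends.Chain' (· > ·)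

/-- A path is increasing if the ends of its successive edges strictly increase. -/
def Increasing {c : ℕ} {f g : ℕ → ℕ} (p : DPath c f g) : Prop :=
  p.ends.Chain' (· < ·)

end DPath

/-- `(s,t)` is a cap of `f`: `s > 0` and there is an ordinary legal move of degree `0`
on `f` with start `s` and end `t`. -/
def IsCap (c : ℕ) (f : ℕ → ℕ) (s t : ℕ) : Prop :=
  0 < s ∧ OrdinaryMove c f s t 0

/-- A non-tail position `u` is free for `f` if `f u = 0` and `u` is not the end of a cap. -/
def IsFree (c : ℕ) (f : ℕ → ℕ) (u : ℕ) : Prop :=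
  0 < u ∧ f u = 0 ∧ ∀ s : ℕ, ¬ IsCap c f s u

/-- A move is regular relative to the initial diagram `μ`: an ordinary move must go along
a cap of `μ`, and a tail or exceptional move must end at a position free for `μ`. -/
def Move.Regular {c : ℕ} {f : ℕ → ℕ} (μ : ℕ → ℕ) : Move c f → Prop
  | .ordinary s t _ _ => IsCap c μ s t
  | .tail t _ _ => IsFree c μ t
  | .exceptional _ t _ _ => IsFree c μ t

/-- A path is regular relative to the initial diagram `μ` if all its edges are. -/
def DPath.RegularFrom {c : ℕ} (μ : ℕ → ℕ) : {f g : ℕ → ℕ} → DPath c f g → Prop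
  | _, _, .nil _ => True
  | _, _, .cons m p => m.Regular μ ∧ p.RegularFrom μ


theorem lval_self_succ (f : ℕ → ℕ) (s : ℕ) : lval f s (s + 1) = 0 := by
  have h : Finset.Ioo s (s + 1) = ∅ := by ext; simp
  simp [lval, h]

theorem lval_succ_right {f : ℕ → ℕ} {s u : ℕ} (hsu : s < u) (hu : f u ≤ 1) :
    lval f s (u + 1) = lval f s u + if f u = 1 then 1 else -1 := by
  have h : Finset.Ioo s (u + 1) = insert u (Finset.Ioo s u) := by
    ext; simp; omega
  have h' : f u = 0 ∨ f u = 1 := by omega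
  rcases h' with h' | h' <;>
    simp [lval, h, Finset.filter_insert, h'] <;> ring

theorem lval_eq_add {f : ℕ → ℕ} (hf : ∀ t, 0 < t → f t ≤ 1) {s a r : ℕ} (hsa : s < a)
    (har : a < r) : lval f s r = lval f s (a + 1) + lval f a r := by
  induction r, har using Nat.le_induction with
  | base => simp [lval_self_succ]
  | succ r hr ih =>
    rw [lval_succ_right (by omega) (hf r (by omega)),
      lval_succ_right (by omega) (hf r (by omega)), ih]
    ring

/-- there are no free positions under a cap. -/
theorem no_free_position_under_cap (c : ℕ) (hc : c ≤ 1) (f : ℕ → ℕ)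
    (hf : IsWeightDiagram f) (s t : ℕ) (hcap : IsCap c f s t) :
    ∀ u : ℕ, s < u → u < t → f u = 1 ∨ ∃ s' : ℕ, IsCap c f s' u := by
  intro u hsu hut
  obtain ⟨hs, hmove⟩ := hcap
  have hone := hf.2
  by_cases hfu : f u = 1
  · exact Or.inl hfu
  right
  have hfu0 : f u = 0 := by have := hone u (by omega); omega
  have hpos : 1 ≤ lval f s u := by
    have h := hmove.nonneg (u + 1) (by omega) (by omega)
    rw [lval_succ_right hsu (hone u (by omega)), if_neg hfu] at h
    omega
  have hsu' : s + 1 < u := by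
    by_contra! h
    obtain rfl : u = s + 1 := by omega
    simp [lval_self_succ] at hpos
  -- The cap ending at `u` starts at the last position where the height is below that of `u`.
  let S := (Finset.Ioo s u).filter fun a => lval f s a < lval f s u
  have hS : S.Nonempty := ⟨s + 1, by simp [S, lval_self_succ]; omega⟩
  obtain ⟨a, haS, hmax⟩ := S.exists_max_image id hS
  simp only [S, Finset.mem_filter, Finset.mem_Ioo, id] at haS hmax
  obtain ⟨⟨hsa, hau⟩, hlt⟩ := haS
  have habove : ∀ r, a < r → r ≤ u → lval f s u ≤ lval f s r := by
    intro r har hru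
    by_contra! h
    rcases hru.eq_or_lt with rfl | hru
    · exact lt_irrefl _ h
    · have := hmax r ⟨⟨by omega, hru⟩, h⟩
      omega
  have hstep := lval_succ_right hsa (hone a (by omega))
  have hnext := habove (a + 1) (by omega) hau
  have hfa : f a = 1 := by
    by_contra h
    rw [if_neg h] at hstep
    omega
  rw [if_pos hfa] at hstep
  refine ⟨a, by omega, hau, hfa.ge, hfu0, by omega, fun r har hru => ?_, ?_⟩
  · have := lval_eq_add hone hsa har
    have := habove r har hru
    omega
  · have := lval_eq_add hone hsa hau
    have := habove u hau le_rfl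
    have := lval_self_succ f a
    push_cast
    omega
end

section
/- Two caps of a weight diagram do not overlap: if (s,t) and (s',t') are caps of a weight diagram f with s < s' < t, then t' < t, so the cap (s',t') is nested strictly inside the cap (s,t). -/
/-- Splitting `l_f(s,t)` at an intermediate position `m` carrying exactly one cross. -/
theorem lval_split {f : ℕ → ℕ} {s m t : ℕ} (hsm : s < m) (hmt : m < t) (hm : f m = 1) :
    lval f s t = lval f s m + 1 + lval f m t := by
  have key (p : ℕ → Prop) [DecidablePred p] :
      ((Finset.Ioo s t).filter p).card = ((Finset.Ioo s m).filter p).card +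
        (if p m then 1 else 0) + ((Finset.Ioo m t).filter p).card := by
    have hIoo : Finset.Ioo s t = (Finset.Ioo s m ∪ {m}) ∪ Finset.Ioo m t := by
      ext r
      simp only [Finset.mem_union, Finset.mem_Ioo, Finset.mem_singleton]
      omega
    rw [hIoo, Finset.filter_union, Finset.card_union_of_disjoint, Finset.filter_union,
      Finset.card_union_of_disjoint, Finset.filter_singleton]
    · split_ifs <;> rfl
    all_goals
      refine Finset.disjoint_left.mpr fun r hr hr' => ?_
      simp only [Finset.mem_filter, Finset.mem_union, Finset.mem_Ioo,
        Finset.mem_singleton] at hr hr'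
      omega
  unfold lval
  rw [key fun r => f r = 1, key fun r => f r = 0]
  simp only [hm, if_true, one_ne_zero, if_false]
  push_cast
  ring

/-- two caps of a weight diagram do not overlap. -/
theorem caps_do_not_overlap (c : ℕ) (hc : c ≤ 1) (f : ℕ → ℕ)
    (hf : IsWeightDiagram f) (s t s' t' : ℕ)
    (h1 : IsCap c f s t) (h2 : IsCap c f s' t')
    (hss' : s < s') (hs't : s' < t) : t' < t := by
  have hs' : f s' = 1 := le_antisymm (hf.2 s' h2.1) h2.2.startCross
  by_contra! h
  have hsplit := lval_split hss' hs't hs'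
  have hleft := h1.2.nonneg s' hss' hs't.le
  have hright := h2.2.nonneg t hs't h
  have hdeg := h1.2.degEq
  push_cast at hdeg
  linarith
end

section
/- Let f be a weight diagram, s > 0 a position with f(s) = 1, and let (s,t) be the cap of f with start s. Then the end of any ordinary legal move on f with start s is not larger than t. -/
theorem lval_succ_of_eq_zero {f : ℕ → ℕ} {s t : ℕ} (hst : s < t) (ht : f t = 0) :
    lval f s (t + 1) = lval f s t - 1 := by
  have h : Finset.Ioo s (t + 1) = insert t (Finset.Ioo s t) := by
    ext r
    simp only [Finset.mem_Ioo, Finset.mem_insert]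
    omega
  simp only [lval, h, Finset.filter_insert, ht]
  simp
  ring

/-- the end of any ordinary legal move on `f` with start `s` is not
larger than the end of the cap of `f` starting at `s`. -/
theorem move_end_le_cap_end (c : ℕ) (hc : c ≤ 1) (f : ℕ → ℕ)
    (hf : IsWeightDiagram f) (s t : ℕ) (hs : 0 < s) (hfs : f s = 1)
    (hcap : IsCap c f s t) :
    ∀ t' w : ℕ, OrdinaryMove c f s t' w → t' ≤ t := by
  intro t' w hmove
  by_contra! hlt
  have hcap := hcap.2
  have hnonneg := hmove.nonneg (t + 1) (hcap.lt.trans t.lt_succ_self) hlt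
  have hdeg := hcap.degEq
  rw [lval_succ_of_eq_zero hcap.lt hcap.endZero] at hnonneg
  push_cast at hdeg
  omega
end

section
/- Let α be a linearly ordered set, n ≥ 1, and t_1, …, t_n a sequence in α with t_i ≠ t_{i+1} for all 1 ≤ i < n. Call a composition of {1,…,n} admissible if the sequence t is strictly decreasing within each of its blocks. Then the sum over all admissible compositions of (−1)^{number of blocks} equals (−1)^n if t_1 < t_2 < … < t_n is strictly increasing, and equals 0 otherwise. -/
/-- The sequence `t` is strictly decreasing within each block of the composition `comp`:
whenever `i < j` lie in the same block, `t i > t j`. -/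
def AdmissibleComposition {α : Type*} [LinearOrder α] {n : ℕ} (t : Fin n → α)
    (comp : Composition n) : Prop :=
  ∀ i j : Fin n, i < j → comp.index i = comp.index j → t j < t i

namespace Composition

/-- Compositions of `m + 1` correspond to subsets of `Fin m`: the set associated with a
composition consists of those `i` such that `i` and `i + 1` lie in the same block. -/
def joinsEquiv (m : ℕ) : Composition (m + 1) ≃ Finset (Fin m) :=
  ((compositionEquiv (m + 1)).trans (compositionAsSetEquiv (m + 1))).trans
    (compl_involutive.toPerm _)

theorem mem_joinsEquiv {m : ℕ} (c : Composition (m + 1)) (i : Fin m) :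
    i ∈ joinsEquiv m c ↔ i.castSucc.succ ∉ c.boundaries := by
  have h : (⟨1 + (i : ℕ), by lia⟩ : Fin (m + 2)) = i.castSucc.succ := by
    ext; simp [add_comm]
  change i ∈ (compositionAsSetEquiv (m + 1) (compositionEquiv (m + 1) c))ᶜ ↔ _
  rw [Finset.mem_compl, ← h]
  exact not_congr (by
    simp only [compositionAsSetEquiv, Equiv.coe_fn_mk, Set.mem_toFinset]
    rfl)

theorem length_add_card_joinsEquiv {m : ℕ} (c : Composition (m + 1)) :
    c.length + (joinsEquiv m c).card = m + 1 := by
  have hb : c.boundaries.card = 2 + (joinsEquiv m c)ᶜ.card := by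
    have h0 : (0 : Fin (m + 2)) ∈ c.boundaries := c.toCompositionAsSet.zero_mem
    have h1 : (Fin.last m).succ ∈ c.boundaries := c.toCompositionAsSet.getLast_mem
    rw [← Finset.filter_univ_mem c.boundaries, ← Finset.filter_univ_mem (joinsEquiv m c)ᶜ,
      Finset.card_filter, Finset.card_filter, Fin.sum_univ_succ, Fin.sum_univ_castSucc]
    simp only [Finset.mem_compl, mem_joinsEquiv, not_not, h0, h1, if_true]
    lia
  have := c.card_boundaries_eq_succ_length
  have := Finset.card_add_card_compl (joinsEquiv m c)
  rw [Fintype.card_fin] at this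
  lia

theorem mem_boundaries_iff {n : ℕ} (c : Composition n) (k : Fin (n + 1)) :
    k ∈ c.boundaries ↔ ∃ l ≤ c.length, c.sizeUpTo l = k := by
  simp only [boundaries, Finset.mem_map, Finset.mem_univ, true_and]
  constructor
  · rintro ⟨l, rfl⟩
    exact ⟨l, Nat.lt_succ_iff.1 l.2, rfl⟩
  · rintro ⟨l, hl, h⟩
    exact ⟨⟨l, Nat.lt_succ_iff.2 hl⟩, Fin.ext h⟩

theorem index_eq_index_iff {m : ℕ} (c : Composition (m + 1)) {i j : Fin (m + 1)} (hij : i ≤ j) :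
    c.index i = c.index j ↔ ∀ k : Fin m, i ≤ k.castSucc → k.succ ≤ j → k ∈ joinsEquiv m c := by
  simp only [mem_joinsEquiv, mem_boundaries_iff, Fin.le_def] at hij ⊢
  have hi := c.lt_sizeUpTo_index_succ i
  have hj := c.lt_sizeUpTo_index_succ j
  have hi' := c.sizeUpTo_index_le i
  have hj' := c.sizeUpTo_index_le j
  simp only [Fin.val_succ] at hi hj
  constructor
  · rintro h k hik hkj ⟨l, -, hl⟩
    simp only [Fin.val_succ, Fin.val_castSucc] at hik hkj hl
    rw [← h] at hj
    rcases Nat.lt_or_ge (c.index i) l with h' | h'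
    · have := c.monotone_sizeUpTo h'
      simp only [Nat.succ_eq_add_one] at this
      lia
    · have := c.monotone_sizeUpTo h'
      lia
  · intro h
    by_contra hne
    have hlt : (c.index i : ℕ) < c.index j := by
      rcases Nat.lt_trichotomy (c.index i) (c.index j) with h' | h' | h'
      · exact h'
      · exact absurd (Fin.ext h') hne
      · have : c.sizeUpTo (c.index j + 1) ≤ c.sizeUpTo (c.index i) := c.monotone_sizeUpTo h'
        lia
    have hle : c.sizeUpTo (c.index i + 1) ≤ c.sizeUpTo (c.index j) := c.monotone_sizeUpTo hlt
    refine h ⟨c.sizeUpTo (c.index i + 1) - 1, by lia⟩ ?_ ?_ ⟨c.index i + 1, (c.index i).2, ?_⟩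
    all_goals simp only [Fin.val_succ, Fin.val_castSucc]; lia

end Composition

theorem admissibleComposition_iff {α : Type*} [LinearOrder α] {m : ℕ} (t : Fin (m + 1) → α)
    (c : Composition (m + 1)) :
    AdmissibleComposition t c ↔
      Composition.joinsEquiv m c ⊆ Finset.univ.filter fun k : Fin m => t k.succ < t k.castSucc := by
  constructor
  · intro h k hk
    rw [Finset.mem_filter_univ]
    refine h _ _ k.castSucc_lt_succ ((c.index_eq_index_iff k.castSucc_lt_succ.le).2 ?_)
    intro l hl hl'
    obtain rfl : l = k :=
      le_antisymm (Fin.succ_le_succ_iff.1 hl') (Fin.castSucc_le_castSucc_iff.1 hl)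
    exact hk
  · intro h i j hij hidx
    rw [c.index_eq_index_iff hij.le] at hidx
    induction j using Fin.induction with
    | zero => exact absurd hij (Fin.not_lt_zero i)
    | succ k ih =>
      have hik : i ≤ k.castSucc := Fin.le_castSucc_iff.2 hij
      have hk := (Finset.mem_filter_univ k).1 (h (hidx k hik le_rfl))
      rcases hik.eq_or_lt with rfl | hlt
      · exact hk
      · exact hk.trans (ih hlt fun l hl hl' => hidx l hl (hl'.trans k.castSucc_lt_succ.le))

theorem finsum_admissibleComposition {α : Type*} [LinearOrder α] {m : ℕ} (t : Fin (m + 1) → α) :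
    (∑ᶠ (c : Composition (m + 1)) (_ : AdmissibleComposition t c), (-1 : ℤ) ^ c.length) =
      if ∀ k : Fin m, ¬ t k.succ < t k.castSucc then (-1) ^ (m + 1) else 0 := by
  classical
  set D := Finset.univ.filter fun k : Fin m => t k.succ < t k.castSucc with hD
  have hsign (c : Composition (m + 1)) :
      (-1 : ℤ) ^ c.length = (-1) ^ (m + 1) * (-1) ^ (Composition.joinsEquiv m c).card := by
    have h := congrArg ((-1 : ℤ) ^ ·) c.length_add_card_joinsEquiv
    rw [← h, pow_add, mul_assoc, ← mul_pow]
    simp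
  have hsum : (∑ᶠ (c : Composition (m + 1)) (_ : AdmissibleComposition t c),
      (-1 : ℤ) ^ c.length) = ∑ s ∈ D.powerset, (-1) ^ (m + 1) * (-1) ^ s.card := by
    rw [finsum_cond_eq_sum_of_cond_iff (t := Finset.univ.filter (AdmissibleComposition t))
      _ (by simp)]
    refine Finset.sum_equiv (Composition.joinsEquiv m) (fun c => ?_) fun c _ => hsign c
    rw [Finset.mem_filter_univ, Finset.mem_powerset, admissibleComposition_iff]
  rw [hsum, ← Finset.mul_sum, Finset.sum_powerset_neg_one_pow_card]
  simp [hD, Finset.filter_eq_empty_iff]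

/-- for a sequence `t_1, …, t_n` (`n ≥ 1`) in a linearly ordered set with
`t_i ≠ t_{i+1}`, the sum of `(−1)^{number of blocks}` over all compositions of `{1,…,n}`
for which `t` is strictly decreasing within each block equals `(−1)^n` if `t` is strictly
increasing, and `0` otherwise. -/
theorem composition_sum_eq (α : Type*) [LinearOrder α] (n : ℕ) (hn : 1 ≤ n)
    (t : Fin n → α)
    (hadj : ∀ (i : ℕ) (h : i + 1 < n), t ⟨i, Nat.lt_of_succ_lt h⟩ ≠ t ⟨i + 1, h⟩) :
    (StrictMono t →
      (∑ᶠ (comp : Composition n) (_ : AdmissibleComposition t comp),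
        ((-1 : ℤ) ^ comp.length)) = (-1 : ℤ) ^ n) ∧
    (¬ StrictMono t →
      (∑ᶠ (comp : Composition n) (_ : AdmissibleComposition t comp),
        ((-1 : ℤ) ^ comp.length)) = 0) := by
  obtain ⟨m, rfl⟩ := Nat.exists_eq_add_of_le' hn
  have hmono : StrictMono t ↔ ∀ k : Fin m, ¬ t k.succ < t k.castSucc := by
    rw [Fin.strictMono_iff_lt_succ]
    refine forall_congr' fun k => ?_
    rw [not_lt]
    exact ⟨le_of_lt, fun h => h.lt_of_ne (hadj k (Nat.succ_lt_succ k.2))⟩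
  rw [finsum_admissibleComposition]
  exact ⟨fun h => if_pos (hmono.1 h), fun h => if_neg (mt hmono.2 h)⟩
end

section
/- For weight diagrams μ and λ define K(λ,μ) as the sum of (−1)^{l(R)} over all decreasing paths R from μ to λ in D, and D(λ,μ) as the sum of (−1)^{l(R)+|R|} over all increasing paths R from μ to λ in D (both sums are finite, and the empty path contributes 1 when μ = λ). Then for all weight diagrams λ and μ one has Σ_ν D(λ,ν)·K(ν,μ) = 1 if λ = μ and = 0 otherwise, where ν runs over all weight diagrams and only finitely many terms of the sum are nonzero. -/
open Classical

/-! The matrices `D` and `K` are inverse to each other: concatenating a decreasing and an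
increasing path gives a zigzag, and shifting the edge with the smallest end across the turning
point is a sign-reversing involution on the nonempty zigzags. -/

theorem lval_le {f : ℕ → ℕ} {N : ℕ} (hN : ∀ r, N ≤ r → f r = 0) {s t : ℕ} (hs : s < N) :
    lval f s t ≤ 2 * (N : ℤ) - t := by
  have h1 : ((Finset.Ioo s t).filter fun r => f r = 1).card ≤ N := by
    calc _ ≤ (Finset.range N).card := by
          apply Finset.card_le_card
          intro r hr
          simp only [Finset.mem_filter, Finset.mem_range] at hr ⊢
          by_contra h
          have := hN r (by omega)
          omega
      _ = N := by simp
  have h0 : t - N ≤ ((Finset.Ioo s t).filter fun r => f r = 0).card := by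
    calc t - N = (Finset.Ico N t).card := by simp
      _ ≤ _ := by
          apply Finset.card_le_card
          intro r hr
          simp only [Finset.mem_filter, Finset.mem_Ico, Finset.mem_Ioo] at hr ⊢
          exact ⟨by omega, hN r hr.1⟩
  unfold lval
  omega

theorem moveX_zero (f : ℕ → ℕ) (t : ℕ) : moveX f 0 t 0 = f 0 - 1 := by simp [moveX]

theorem moveX_end {f : ℕ → ℕ} {s t : ℕ} (h : s < t) : moveX f s t t = f t + 1 := by
  simp [moveX, h.ne']

theorem IsWeightDiagram.exists_bound {f : ℕ → ℕ} (hf : IsWeightDiagram f) :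
    ∃ N, 0 < N ∧ ∀ r, N ≤ r → f r = 0 := by
  obtain ⟨M, hM⟩ := hf.1.bddAbove
  refine ⟨M + 1, by omega, fun r hr => ?_⟩
  by_contra h
  have := hM (Function.mem_support.2 h)
  omega

theorem IsWeightDiagram.moveX {f : ℕ → ℕ} (hf : IsWeightDiagram f) {s t : ℕ} (ht : f t = 0) :
    IsWeightDiagram (moveX f s t) := by
  refine ⟨(hf.1.union (Set.finite_singleton t)).subset fun r hr => ?_, fun r hr => ?_⟩
  · by_contra h
    simp only [Set.mem_union, Function.mem_support, Set.mem_singleton_iff, not_or, not_not] at h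
    apply hr
    by_cases hs : r = s
    · subst hs; simp [_root_.moveX, h.1]
    · simp [_root_.moveX, h.1, h.2, hs]
  · unfold _root_.moveX
    have h1 := hf.2 r hr
    split_ifs with h h'
    · subst h; omega
    · omega
    · exact h1

/-- The sum of the positions of the crosses of a diagram. -/
noncomputable def crossSum (f : ℕ → ℕ) : ℕ := ∑ᶠ r, r * f r

theorem crossSum_lt_moveX {f : ℕ → ℕ} (hf : IsWeightDiagram f) {s t : ℕ} (hst : s < t)
    (hs : 1 ≤ f s) (ht : f t = 0) : crossSum f < crossSum (moveX f s t) := by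
  obtain ⟨N, -, hN⟩ := hf.exists_bound
  obtain ⟨N', -, hN'⟩ := (hf.moveX (s := s) ht).exists_bound
  have key : ∀ g : ℕ → ℕ, (∀ r, N + N' + t + 1 ≤ r → g r = 0) →
      crossSum g = ∑ r ∈ Finset.range (N + N' + t + 1), r * g r := by
    intro g hg
    apply finsum_eq_sum_of_support_subset
    intro r hr
    by_contra h
    simp only [Finset.coe_range, Set.mem_Iio, not_lt] at h
    exact hr (by simp [hg r h])
  rw [key f fun r hr => hN r (by omega), key _ fun r hr => hN' r (by omega)]
  have : ∑ r ∈ Finset.range (N + N' + t + 1), r * moveX f s t r + s =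
      ∑ r ∈ Finset.range (N + N' + t + 1), r * f r + t := by
    calc _ = ∑ r ∈ Finset.range (N + N' + t + 1), (r * moveX f s t r + if r = s then r else 0) := by
          simp only [Finset.sum_add_distrib, Finset.sum_ite_eq', Finset.mem_range]
          rw [if_pos (by omega)]
      _ = ∑ r ∈ Finset.range (N + N' + t + 1), (r * f r + if r = t then r else 0) := by
          refine Finset.sum_congr rfl fun r _ => ?_
          unfold moveX
          by_cases h : r = s
          · subst h
            obtain ⟨k, hk⟩ := Nat.exists_eq_add_of_le' hs
            simp [hst.ne, hk, Nat.mul_succ]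
          · by_cases h' : r = t
            · subst h'; simp [h]; ring
            · simp [h, h']
      _ = _ := by
          simp only [Finset.sum_add_distrib, Finset.sum_ite_eq', Finset.mem_range]
          rw [if_pos (by omega)]
  omega

namespace Move

variable {c : ℕ} {f : ℕ → ℕ}

theorem isWeightDiagram_target (hf : IsWeightDiagram f) (m : Move c f) :
    IsWeightDiagram m.target := by
  cases m with
  | ordinary s t w h => exact hf.moveX h.endZero
  | tail t w h => exact hf.moveX h.endZero
  | exceptional s t w h =>
    refine (hf.moveX h.sZero).moveX ?_
    have h1 := h.sPos
    have h2 := h.lt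
    simp [moveX, h.endZero, h2.ne', (h1.trans h2).ne']

theorem crossSum_lt_target (hf : IsWeightDiagram f) (m : Move c f) :
    crossSum f < crossSum m.target := by
  cases m with
  | ordinary s t w h => exact crossSum_lt_moveX hf h.lt h.startCross h.endZero
  | tail t w h => exact crossSum_lt_moveX hf h.pos h.startCross h.endZero
  | exceptional s t w h =>
    have h1 := h.sPos
    have h2 := h.lt
    have h3 := h.twoCrosses
    refine (crossSum_lt_moveX hf h1 (by omega) h.sZero).trans
      (crossSum_lt_moveX (hf.moveX h.sZero) (h1.trans h2) ?_ ?_)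
    · rw [moveX_zero]; omega
    · simp [moveX, h.endZero, h2.ne', (h1.trans h2).ne']

theorem endPos_eq_zero (m : Move c f) : f m.endPos = 0 := by
  cases m with
  | ordinary s t w h => exact h.endZero
  | tail t w h => exact h.endZero
  | exceptional s t w h => exact h.endZero

theorem target_endPos_ne_zero (m : Move c f) : m.target m.endPos ≠ 0 := by
  cases m with
  | ordinary s t w h => simp [target, endPos, moveX_end h.lt]
  | tail t w h => simp [target, endPos, moveX_end h.pos]
  | exceptional s t w h => simp [target, endPos, moveX_end (h.sPos.trans h.lt)]

theorem endPos_ne_endPos (m : Move c f) (m' : Move c m.target) : m.endPos ≠ m'.endPos := by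
  intro h
  exact m.target_endPos_ne_zero (h ▸ m'.endPos_eq_zero)

/-- The kind of a move together with its start (or intermediate position) and its end. -/
def code : Move c f → ℕ × ℕ × ℕ
  | ordinary s t _ _ => (0, s, t)
  | tail t _ _ => (1, 0, t)
  | exceptional s t _ _ => (2, s, t)

theorem code_injective : Function.Injective (code : Move c f → ℕ × ℕ × ℕ) := by
  intro m m' h
  rcases m with ⟨s, t, w, hm⟩ | ⟨t, w, hm⟩ | ⟨s, t, w, hm⟩ <;>
  rcases m' with ⟨s', t', w', hm'⟩ | ⟨t', w', hm'⟩ | ⟨s', t', w', hm'⟩ <;>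
  simp [code] at h
  · obtain ⟨rfl, rfl⟩ := h
    obtain rfl : w = w' := by have := hm.degEq; have := hm'.degEq; omega
    rfl
  · subst h
    obtain rfl : w = w' := by have := hm.degEq; have := hm'.degEq; omega
    rfl
  · obtain ⟨rfl, rfl⟩ := h
    obtain rfl : w = w' := by have := hm.degEq; have := hm'.degEq; omega
    rfl

theorem finite (hf : IsWeightDiagram f) : Finite (Move c f) := by
  obtain ⟨N, hN0, hN⟩ := hf.exists_bound
  set B := 2 * N + 2 * f 0 + c with hB
  have hfin : (Set.range (code : Move c f → ℕ × ℕ × ℕ)).Finite := by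
    refine (((Set.finite_Iic 2).prod ((Set.finite_Iic B).prod
      (Set.finite_Iic (2 * (N + B + 1)))))).subset ?_
    rintro _ ⟨m, rfl⟩
    rcases m with ⟨s, t, w, h⟩ | ⟨t, w, h⟩ | ⟨s, t, w, h⟩
    · have hs : s < N := by
        by_contra hs
        have := hN s (by omega)
        have := h.startCross
        omega
      have h1 := lval_le hN hs (t := t)
      have h2 := h.nonneg t h.lt le_rfl
      simp only [code, Set.mem_prod, Set.mem_Iic]
      omega
    · have h1 := lval_le hN hN0 (t := t)
      have h2 := h.nonneg
      rw [wsize, moveX_zero] at h2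
      simp only [code, Set.mem_prod, Set.mem_Iic]
      omega
    · have h1 := lval_le hN hN0 (t := s)
      have h2 := h.oddPos
      rw [wsize, moveX_zero, moveX_zero] at h2
      have hs : s ≤ B := by omega
      have h3 := lval_le (f := f) (N := N + B + 1) (fun r hr => hN r (by omega))
        (show s < N + B + 1 by omega) (t := t)
      have h4 := h.mid t h.lt le_rfl
      simp only [code, Set.mem_prod, Set.mem_Iic]
      omega
  have := hfin.to_subtype
  exact Finite.of_injective _ (Set.rangeFactorization_injective.2 code_injective)

end Move

namespace DPath

variable {c : ℕ}

theorem isWeightDiagram_target {f g : ℕ → ℕ} (p : DPath c f g) (hf : IsWeightDiagram f) :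
    IsWeightDiagram g := by
  induction p with
  | nil => exact hf
  | cons m p ih => exact ih (m.isWeightDiagram_target hf)

theorem length_add_crossSum_le {f g : ℕ → ℕ} (p : DPath c f g) (hf : IsWeightDiagram f) :
    p.length + crossSum f ≤ crossSum g := by
  induction p with
  | nil => simp [length]
  | cons m p ih =>
    have h1 := ih (m.isWeightDiagram_target hf)
    have h2 := m.crossSum_lt_target hf
    simp only [length]
    omega

theorem finite_length_le (n : ℕ) {f : ℕ → ℕ} (hf : IsWeightDiagram f) :
    Finite {x : Σ g, DPath c f g // x.2.length ≤ n} := by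
  induction n generalizing f with
  | zero =>
    refine Finite.of_surjective (α := Unit)
      (fun _ => ⟨⟨f, nil f⟩, by simp [length]⟩) ?_
    rintro ⟨⟨g, p⟩, hp⟩
    cases p with
    | nil => exact ⟨(), rfl⟩
    | cons m p => simp [length] at hp
  | succ n ih =>
    have := Move.finite (c := c) hf
    have := fun m : Move c f => ih (m.isWeightDiagram_target hf)
    refine Finite.of_surjective
      (α := Option (Σ m : Move c f, {x : Σ g, DPath c m.target g // x.2.length ≤ n}))
      (fun o => match o with
        | none => ⟨⟨f, nil f⟩, by simp [length]⟩
        | some ⟨m, ⟨⟨g, p⟩, hp⟩⟩ => ⟨⟨g, cons m p⟩, by simpa [length] using hp⟩) ?_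
    rintro ⟨⟨g, p⟩, hp⟩
    cases p with
    | nil => exact ⟨none, rfl⟩
    | cons m p => exact ⟨some ⟨m, ⟨⟨g, p⟩, by simpa [length] using hp⟩⟩, rfl⟩

theorem finite {f : ℕ → ℕ} (hf : IsWeightDiagram f) (g : ℕ → ℕ) : Finite (DPath c f g) := by
  have := finite_length_le (c := c) (crossSum g) hf
  refine Finite.of_injective (β := {x : Σ g, DPath c f g // x.2.length ≤ crossSum g})
    (fun p => ⟨⟨g, p⟩, show p.length ≤ _ by have := p.length_add_crossSum_le hf; omega⟩) ?_
  intro p p' h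
  simpa using h

theorem finite_sigma_prod {f : ℕ → ℕ} (hf : IsWeightDiagram f) (h : ℕ → ℕ) :
    Finite (Σ g, DPath c f g × DPath c g h) := by
  have := finite_length_le (c := c) (crossSum h) hf
  have := fun x : {x : Σ g, DPath c f g // x.2.length ≤ crossSum h} =>
    finite (c := c) (x.1.2.isWeightDiagram_target hf) h
  refine Finite.of_surjective
    (α := Σ x : {x : Σ g, DPath c f g // x.2.length ≤ crossSum h}, DPath c x.1.1 h)
    (fun y => ⟨y.1.1.1, y.1.1.2, y.2⟩) ?_
  rintro ⟨g, q, p⟩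
  have h1 := q.length_add_crossSum_le hf
  have h2 := p.length_add_crossSum_le (q.isWeightDiagram_target hf)
  exact ⟨⟨⟨⟨g, q⟩, show q.length ≤ _ by omega⟩, p⟩, rfl⟩

end DPath

/-- Paths in the graph `D`, built by appending edges at the end. -/
inductive SnocPath (c : ℕ) (f : ℕ → ℕ) : (ℕ → ℕ) → Type
  | nil : SnocPath c f f
  | snoc {g : ℕ → ℕ} (q : SnocPath c f g) (m : Move c g) : SnocPath c f m.target

namespace SnocPath

variable {c : ℕ} {f : ℕ → ℕ}

/-- The degree of a path. -/
def deg : {g : ℕ → ℕ} → SnocPath c f g → ℕ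
  | _, nil => 0
  | _, snoc q m => q.deg + m.deg

/-- The ends of the edges of a path, from the last edge to the first. -/
def revEnds : {g : ℕ → ℕ} → SnocPath c f g → List ℕ
  | _, nil => []
  | _, snoc q m => m.endPos :: q.revEnds

/-- Prepend a path to a path of type `DPath`. -/
def append {h : ℕ → ℕ} : {g : ℕ → ℕ} → SnocPath c f g → DPath c g h → DPath c f h
  | _, nil, p => p
  | _, snoc q m, p => q.append (.cons m p)

/-- Append a path of type `DPath` to a path. -/
def extend : {g h : ℕ → ℕ} → SnocPath c f g → DPath c g h → SnocPath c f h
  | _, _, q, .nil _ => q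
  | _, _, q, .cons m p => (q.snoc m).extend p

theorem extend_append {g h : ℕ → ℕ} (q : SnocPath c f g) (p : DPath c g h) :
    (nil : SnocPath c f f).extend (q.append p) = q.extend p := by
  induction q with
  | nil => rfl
  | snoc q m ih => rw [append, ih, extend]

theorem append_extend {g h : ℕ → ℕ} (q : SnocPath c f g) (p : DPath c g h) :
    (q.extend p).append (.nil h) = q.append p := by
  induction p with
  | nil => rfl
  | cons m p ih => rw [extend, ih, append]

theorem deg_append {g h : ℕ → ℕ} (q : SnocPath c f g) (p : DPath c g h) :
    (q.append p).deg = q.deg + p.deg := by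
  induction q with
  | nil => simp [append, deg]
  | snoc q m ih => rw [append, ih, deg, DPath.deg]; ring

theorem ends_append {g h : ℕ → ℕ} (q : SnocPath c f g) (p : DPath c g h) :
    (q.append p).ends = q.revEnds.reverse ++ p.ends := by
  induction q with
  | nil => simp [append, revEnds]
  | snoc q m ih => rw [append, ih, revEnds, DPath.ends]; simp

/-- The two types of paths agree. -/
def equivDPath (c : ℕ) (f g : ℕ → ℕ) : SnocPath c f g ≃ DPath c f g where
  toFun q := q.append (.nil g)
  invFun p := (nil : SnocPath c f f).extend p
  left_inv q := extend_append q (.nil g)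
  right_inv p := append_extend _ p

theorem deg_equivDPath {g : ℕ → ℕ} (q : SnocPath c f g) : (equivDPath c f g q).deg = q.deg :=
  (q.deg_append _).trans (by simp [DPath.deg])

theorem decreasing_equivDPath {g : ℕ → ℕ} (q : SnocPath c f g) :
    (equivDPath c f g q).Decreasing ↔ q.revEnds.IsChain (· < ·) := by
  change (q.append (.nil g)).ends.IsChain (· > ·) ↔ _
  rw [ends_append, DPath.ends, List.append_nil, List.isChain_reverse]

end SnocPath

/-- Pairs of composable paths from `f` to `h`. -/
abbrev Zigzag (c : ℕ) (f h : ℕ → ℕ) : Type := Σ g, SnocPath c f g × DPath c g h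

namespace Zigzag

variable {c : ℕ} {f h : ℕ → ℕ}

/-- The first path is decreasing and the second one is increasing. -/
def Monotone (z : Zigzag c f h) : Prop :=
  z.2.1.revEnds.IsChain (· < ·) ∧ z.2.2.ends.IsChain (· < ·)

/-- Both paths are empty. -/
def Trivial (z : Zigzag c f h) : Prop :=
  z.2.1.revEnds = [] ∧ z.2.2.ends = []

/-- The contribution of a pair of paths to the product of the matrices `D` and `K`. -/
def sign (z : Zigzag c f h) : ℤ :=
  (-1) ^ (z.2.2.deg + z.2.2.length) * (-1) ^ z.2.1.deg

/-- Move the edge with the smallest end across the turning point. -/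
def flip : {h : ℕ → ℕ} → Zigzag c f h → Zigzag c f h
  | _, ⟨_, .nil, .nil _⟩ => ⟨_, .nil, .nil _⟩
  | _, ⟨_, .nil, .cons m p⟩ => ⟨_, .snoc .nil m, p⟩
  | _, ⟨_, .snoc q m, .nil _⟩ => ⟨_, q, .cons m (.nil _)⟩
  | _, ⟨_, .snoc q m, .cons m' p⟩ =>
    if m.endPos < m'.endPos then ⟨_, q, .cons m (.cons m' p)⟩ else ⟨_, .snoc (.snoc q m) m', p⟩

theorem flip_monotone (z : Zigzag c f h) (hz : z.Monotone) : z.flip.Monotone := by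
  obtain ⟨g, q, p⟩ := z
  obtain ⟨hq, hp⟩ := hz
  cases q with
  | nil =>
    cases p with
    | nil => exact ⟨hq, hp⟩
    | cons m p => exact ⟨by simp [flip, SnocPath.revEnds], hp.tail⟩
  | snoc q m =>
    cases p with
    | nil => exact ⟨hq.tail, by simp [flip, DPath.ends]⟩
    | cons m' p =>
      have hne := m.endPos_ne_endPos m'
      simp only [flip]
      split_ifs with hlt
      · exact ⟨hq.tail, List.isChain_cons_cons.2 ⟨hlt, hp⟩⟩
      · exact ⟨List.isChain_cons_cons.2 ⟨by omega, hq⟩, hp.tail⟩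

theorem flip_flip (z : Zigzag c f h) (hz : z.Monotone) : z.flip.flip = z := by
  obtain ⟨g, q, p⟩ := z
  obtain ⟨hq, hp⟩ := hz
  cases q with
  | nil =>
    cases p with
    | nil => rfl
    | cons m p =>
      cases p with
      | nil => rfl
      | cons m' p =>
        have hlt : m.endPos < m'.endPos := (List.isChain_cons_cons.1 hp).1
        simp [flip, hlt]
  | snoc q m =>
    cases p with
    | nil =>
      cases q with
      | nil => rfl
      | snoc q m₀ =>
        have hlt : m.endPos < m₀.endPos := (List.isChain_cons_cons.1 hq).1
        simp [flip, hlt.le]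
    | cons m' p =>
      by_cases hlt : m.endPos < m'.endPos
      · cases q with
        | nil => simp [flip, hlt]
        | snoc q m₀ =>
          have hlt' : m.endPos < m₀.endPos := (List.isChain_cons_cons.1 hq).1
          simp [flip, hlt, hlt'.le]
      · cases p with
        | nil => simp [flip, hlt]
        | cons m₁ p =>
          have hlt' : m'.endPos < m₁.endPos := (List.isChain_cons_cons.1 hp).1
          simp [flip, hlt, hlt']

theorem flip_trivial (z : Zigzag c f h) (hz : ¬ z.Trivial) : ¬ z.flip.Trivial := by
  obtain ⟨g, q, p⟩ := z
  rcases q with _ | ⟨q, m⟩ <;> rcases p with _ | ⟨m', p⟩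
  · exact hz
  · simp [flip, Trivial, SnocPath.revEnds]
  · simp [flip, Trivial, DPath.ends]
  · simp only [flip]
    split_ifs <;> simp [Trivial, SnocPath.revEnds, DPath.ends]

theorem sign_flip (z : Zigzag c f h) (hz : ¬ z.Trivial) : z.flip.sign = -z.sign := by
  obtain ⟨g, q, p⟩ := z
  rcases q with _ | ⟨q, m⟩ <;> rcases p with _ | ⟨m', p⟩
  · exact absurd ⟨rfl, rfl⟩ hz
  · simp only [flip, sign, SnocPath.deg, DPath.deg, DPath.length]
    ring
  · simp only [flip, sign, SnocPath.deg, DPath.deg, DPath.length]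
    ring
  · simp only [flip]
    split_ifs <;> simp only [sign, SnocPath.deg, DPath.deg, DPath.length] <;> ring

theorem finite (c : ℕ) {f : ℕ → ℕ} (hf : IsWeightDiagram f) (h : ℕ → ℕ) :
    Finite (Zigzag c f h) := by
  have := DPath.finite_sigma_prod (c := c) hf h
  exact Finite.of_equiv _
    (Equiv.sigmaCongrRight fun g => (SnocPath.equivDPath c f g).symm.prodCongr (Equiv.refl _))

theorem sum_sign [Fintype (Zigzag c f h)] :
    ∑ z : Zigzag c f h, (if z.Monotone then z.sign else 0) = if h = f then 1 else 0 := by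
  rw [← Finset.sum_filter,
    ← Finset.sum_filter_add_sum_filter_not (Finset.univ.filter Monotone) Trivial]
  have hzero : ∑ z ∈ (Finset.univ.filter (Monotone (c := c) (f := f) (h := h))).filter
      (fun z => ¬ z.Trivial), z.sign = 0 := by
    refine Finset.sum_involution (fun z _ => z.flip) ?_ ?_ ?_ ?_
    · intro z hz
      rw [sign_flip z (Finset.mem_filter.1 hz).2, add_neg_cancel]
    · intro z hz h0 heq
      have := sign_flip z (Finset.mem_filter.1 hz).2
      rw [heq] at this
      omega
    · intro z hz
      simp only [Finset.mem_filter, Finset.mem_univ, true_and] at hz ⊢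
      exact ⟨flip_monotone z hz.1, flip_trivial z hz.2⟩
    · intro z hz
      simp only [Finset.mem_filter, Finset.mem_univ, true_and] at hz
      exact flip_flip z hz.1
  rw [hzero, add_zero]
  split_ifs with heq
  · subst heq
    rw [Finset.sum_eq_single_of_mem (⟨h, .nil, .nil h⟩ : Zigzag c h h)]
    · simp [sign, DPath.deg, DPath.length, SnocPath.deg]
    · exact Finset.mem_filter.2 ⟨Finset.mem_filter.2
        ⟨Finset.mem_univ _, List.isChain_nil, List.isChain_nil⟩, rfl, rfl⟩
    · rintro ⟨g, q, p⟩ hz hne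
      have ht := (Finset.mem_filter.1 hz).2
      rcases q with _ | ⟨q, m⟩
      · rcases p with _ | ⟨m', p⟩
        · exact absurd rfl hne
        · simp [Trivial, DPath.ends] at ht
      · simp [Trivial, SnocPath.revEnds] at ht
  · apply Finset.sum_eq_zero
    rintro ⟨g, q, p⟩ hz
    have ht := (Finset.mem_filter.1 hz).2
    rcases q with _ | ⟨q, m⟩
    · rcases p with _ | ⟨m', p⟩
      · exact absurd rfl heq
      · simp [Trivial, DPath.ends] at ht
    · simp [Trivial, SnocPath.revEnds] at ht

theorem sum_sign_fiber (g : ℕ → ℕ) [inst : Fintype (SnocPath c f g × DPath c g h)]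
    [Finite (DPath c f g)] [Finite (DPath c g h)] :
    ∑ x : SnocPath c f g × DPath c g h,
        (if Monotone ⟨g, x⟩ then sign ⟨g, x⟩ else 0) =
      (∑ᶠ (p : DPath c g h) (_ : p.Increasing), ((-1 : ℤ) ^ (p.deg + p.length))) *
        (∑ᶠ (q : DPath c f g) (_ : q.Decreasing), ((-1 : ℤ) ^ q.deg)) := by
  have := Fintype.ofFinite (DPath c f g)
  have := Fintype.ofFinite (DPath c g h)
  have := Fintype.ofEquiv _ (SnocPath.equivDPath c f g).symm
  obtain rfl : inst = instFintypeProd _ _ := Subsingleton.elim _ _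
  simp only [finsum_eq_if, finsum_eq_sum_of_fintype]
  rw [← (SnocPath.equivDPath c f g).sum_comp, Finset.sum_mul_sum, Finset.sum_comm,
    ← Fintype.sum_prod_type']
  refine Fintype.sum_equiv (Equiv.refl _) _ _ ?_
  rintro ⟨q, p⟩
  simp only [SnocPath.decreasing_equivDPath, SnocPath.deg_equivDPath, Monotone, sign,
    Equiv.refl_apply]
  have hp : p.Increasing ↔ p.ends.IsChain (· < ·) := Iff.rfl
  simp only [← hp]
  by_cases h1 : q.revEnds.IsChain (· < ·) <;> by_cases h2 : p.Increasing <;>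
    simp [h1, h2]

end Zigzag

/-- the matrices `D` and `K` are inverse to each other. -/
theorem D_K_inverse (c : ℕ) (hc : c ≤ 1) (lam mu : ℕ → ℕ)
    (hlam : IsWeightDiagram lam) (hmu : IsWeightDiagram mu) :
    {nu : ℕ → ℕ | IsWeightDiagram nu ∧
        (∑ᶠ (p : DPath c nu lam) (_ : p.Increasing), ((-1 : ℤ) ^ (p.deg + p.length))) *
          (∑ᶠ (q : DPath c mu nu) (_ : q.Decreasing), ((-1 : ℤ) ^ q.deg)) ≠ 0}.Finite ∧
    (∑ᶠ (nu : ℕ → ℕ) (_ : IsWeightDiagram nu),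
        (∑ᶠ (p : DPath c nu lam) (_ : p.Increasing), ((-1 : ℤ) ^ (p.deg + p.length))) *
          (∑ᶠ (q : DPath c mu nu) (_ : q.Decreasing), ((-1 : ℤ) ^ q.deg))) =
      (if lam = mu then 1 else 0) := by
  set T : (ℕ → ℕ) → ℤ := fun nu =>
    (∑ᶠ (p : DPath c nu lam) (_ : p.Increasing), ((-1 : ℤ) ^ (p.deg + p.length))) *
      (∑ᶠ (q : DPath c mu nu) (_ : q.Decreasing), ((-1 : ℤ) ^ q.deg)) with hT
  have := Zigzag.finite c hmu lam
  have := Fintype.ofFinite (Zigzag c mu lam)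
  have hfib : ∀ nu, Finite (SnocPath c mu nu × DPath c nu lam) := fun nu =>
    Finite.of_injective (fun x => (⟨nu, x⟩ : Zigzag c mu lam)) fun x y h => by simpa using h
  have := fun nu => Fintype.ofFinite (SnocPath c mu nu × DPath c nu lam)
  have hterm : ∀ nu, (if IsWeightDiagram nu then T nu else 0) =
      ∑ x : SnocPath c mu nu × DPath c nu lam,
        (if Zigzag.Monotone ⟨nu, x⟩ then Zigzag.sign ⟨nu, x⟩ else 0) := by
    intro nu
    split_ifs with hnu
    · have := DPath.finite (c := c) hmu nu
      have := DPath.finite (c := c) hnu lam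
      exact (Zigzag.sum_sign_fiber nu).symm
    · refine (Finset.sum_eq_zero fun x _ => ?_).symm
      exact absurd ((SnocPath.equivDPath c mu nu x.1).isWeightDiagram_target hmu) hnu
  set S : Finset (ℕ → ℕ) := Finset.univ.image (Sigma.fst : Zigzag c mu lam → ℕ → ℕ) with hS
  have hsub : (Function.support fun nu => if IsWeightDiagram nu then T nu else 0) ⊆ S := by
    intro nu hnu
    rw [Function.mem_support, hterm] at hnu
    obtain ⟨x, -, -⟩ := Finset.exists_ne_zero_of_sum_ne_zero hnu
    exact Finset.mem_coe.2 (Finset.mem_image.2 ⟨⟨nu, x⟩, Finset.mem_univ _, rfl⟩)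
  refine ⟨S.finite_toSet.subset fun nu hnu => hsub ?_, ?_⟩
  · rw [Function.mem_support, if_pos hnu.1]
    exact hnu.2
  · change ∑ᶠ (nu) (_ : IsWeightDiagram nu), T nu = _
    simp only [finsum_eq_if (x := T _)]
    rw [finsum_eq_sum_of_support_subset _ hsub, ← Zigzag.sum_sign (c := c) (f := mu) (h := lam)]
    simp only [hterm]
    rw [Finset.sum_sigma']
    refine Finset.sum_congr ?_ fun _ _ => rfl
    ext z
    simp only [Finset.mem_sigma, Finset.mem_univ, and_true, iff_true]
    exact Finset.mem_image_of_mem _ (Finset.mem_univ z)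
end

section
/- Let R be a decreasing path in D from μ to λ whose edges end at positions t_1 > t_2 > … > t_q. Then λ(t_j) ≥ 1 for every j; in particular the number of edges of any decreasing path from μ to λ is at most the total number Σ_t λ(t) of crosses of λ. -/
theorem Move.one_le_target_endPos {c : ℕ} {f : ℕ → ℕ} (m : Move c f) :
    1 ≤ m.target m.endPos := by
  cases m with
  | ordinary s t w h =>
    have := h.lt
    simp [Move.target, Move.endPos, moveX, this.ne']
  | tail t w h =>
    have := h.pos
    simp [Move.target, Move.endPos, moveX, this.ne']
  | exceptional s t w h =>
    have := h.sPos.trans h.lt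
    simp [Move.target, Move.endPos, moveX, this.ne']

theorem Move.target_apply_of_endPos_lt {c : ℕ} {f : ℕ → ℕ} (m : Move c f) {r : ℕ}
    (hr : m.endPos < r) : m.target r = f r := by
  cases m with
  | ordinary s t w h =>
    have h1 := h.lt
    simp only [Move.endPos] at hr
    simp [Move.target, moveX, hr.ne', (h1.trans hr).ne']
  | tail t w h =>
    have h1 := h.pos
    simp only [Move.endPos] at hr
    simp [Move.target, moveX, hr.ne', (h1.trans hr).ne']
  | exceptional s t w h =>
    have h1 := h.lt
    have h2 := h.sPos.trans h1
    simp only [Move.endPos] at hr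
    simp [Move.target, moveX, hr.ne', (h1.trans hr).ne', (h2.trans hr).ne']

theorem DPath.apply_eq_of_ends_lt {c : ℕ} {f g : ℕ → ℕ} (p : DPath c f g) {r : ℕ}
    (hr : ∀ t ∈ p.ends, t < r) : g r = f r := by
  induction p with
  | nil f => rfl
  | cons m p ih =>
    simp only [DPath.ends, List.mem_cons, forall_eq_or_imp] at hr
    rw [ih hr.2, m.target_apply_of_endPos_lt hr.1]

theorem DPath.one_le_apply_of_mem_ends {c : ℕ} {f g : ℕ → ℕ} (p : DPath c f g)
    (hp : p.ends.Pairwise (· > ·)) : ∀ t ∈ p.ends, 1 ≤ g t := by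
  induction p with
  | nil f => simp [DPath.ends]
  | cons m p ih =>
    simp only [DPath.ends, List.pairwise_cons] at hp
    simp only [DPath.ends, List.mem_cons, forall_eq_or_imp]
    refine ⟨?_, ih hp.2⟩
    rw [p.apply_eq_of_ends_lt hp.1]
    exact m.one_le_target_endPos

theorem DPath.length_ends {c : ℕ} {f g : ℕ → ℕ} (p : DPath c f g) :
    p.ends.length = p.length := by
  induction p with
  | nil f => rfl
  | cons m p ih => simp [DPath.ends, DPath.length, ih]

/-- along a decreasing path from `μ` to `lam`, the final diagram `lam` has a
cross at the end of every edge; in particular the number of edges is at most the number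
of crosses of `lam`. -/
theorem decreasing_path_ends_are_crosses (c : ℕ) (hc : c ≤ 1) (mu lam : ℕ → ℕ)
    (hmu : IsWeightDiagram mu) (hlam : IsWeightDiagram lam)
    (p : DPath c mu lam) (hdec : p.Decreasing) :
    (∀ t ∈ p.ends, 1 ≤ lam t) ∧ p.length ≤ ∑ᶠ t : ℕ, lam t := by
  have hpw : p.ends.Pairwise (· > ·) := List.isChain_iff_pairwise.mp hdec
  have hends := p.one_le_apply_of_mem_ends hpw
  refine ⟨hends, ?_⟩
  have hnd : p.ends.Nodup := hpw.imp fun h => h.ne'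
  have hsub : p.ends.toFinset ⊆ hlam.1.toFinset := fun t ht => by
    have := hends t (List.mem_toFinset.mp ht)
    simp only [Set.Finite.mem_toFinset, Function.mem_support]
    lia
  calc p.length = ∑ _t ∈ p.ends.toFinset, 1 := by
        rw [Finset.sum_const, smul_eq_mul, mul_one, List.toFinset_card_of_nodup hnd,
          p.length_ends]
    _ ≤ ∑ t ∈ p.ends.toFinset, lam t :=
        Finset.sum_le_sum fun t ht => hends t (List.mem_toFinset.mp ht)
    _ ≤ ∑ t ∈ hlam.1.toFinset, lam t := Finset.sum_le_sum_of_subset hsub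
    _ = ∑ᶠ t : ℕ, lam t := (finsum_eq_sum lam hlam.1).symm
end
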